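/- arXiv:1608.03873 — 3 statements merged into one kernel-verified Lean document; each statement's English description precedes it below -/
import Mathlib

section
/- Suppose 𝒟 is a linear operator on real polynomials with 𝒟(ℙ^ν) ⊆ ℙ^ν for every ν and 𝒟p_ν = μ_ν p_ν for ν = 0, 1, …, N−1. Let x_1,…,x_N be ANY N pairwise distinct real numbers (not necessarily zeros of p_N) and let D^c be the N×N matrix with entries D^c_{nk} = (𝒟ℓ_k)(x_n). Then D^c is similar to the diagonal matrix diag(μ_0, μ_1, …, μ_{N−1}); in particular, the eigenvalues of D^c are μ_0,…,μ_{N−1}, independently of the choice of the nodes x_1,…,x_N. -/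
open Polynomial MeasureTheory Finset

/-- The Lagrange interpolation basis polynomial `ℓ_j` with respect to the nodes `x`,
i.e. `ℓ_j(t) = ψ(t)/(ψ'(x_j)(t - x_j)) = ∏_{k ≠ j} (t - x_k)/(x_j - x_k)`. -/
noncomputable def lag {N : ℕ} (x : Fin N → ℝ) (j : Fin N) : Polynomial ℝ :=
  ∏ k ∈ Finset.univ.erase j, Polynomial.C (x j - x k)⁻¹ * (Polynomial.X - Polynomial.C (x k))

theorem lag_eq_lagrange_basis {N : ℕ} (x : Fin N → ℝ) (j : Fin N) :
    lag x j = Lagrange.basis Finset.univ x j := rfl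

theorem sum_eval_smul_lag {N : ℕ} {x : Fin N → ℝ} (hx : Function.Injective x)
    {q : Polynomial ℝ} (hq : q.degree < N) :
    ∑ k, q.eval (x k) • lag x k = q := by
  have h := Lagrange.eq_interpolate (s := Finset.univ) (v := x) (f := q) hx.injOn (by simpa using hq)
  rw [Lagrange.interpolate_apply] at h
  conv_rhs => rw [h]
  simp only [lag_eq_lagrange_basis, Polynomial.smul_eq_C_mul]

/-- The collocation matrix of polynomials of degrees `0, 1, …, N - 1` at `N` distinct nodes is
invertible. -/
theorem isUnit_collocation {p : ℕ → Polynomial ℝ} (hdeg : ∀ ν : ℕ, (p ν).degree = ν)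
    {N : ℕ} {x : Fin N → ℝ} (hx : Function.Injective x) :
    IsUnit (Matrix.of fun n ν : Fin N => (p ν).eval (x n)) := by
  rw [← Matrix.mulVec_injective_iff_isUnit]
  refine (injective_iff_map_eq_zero (Matrix.mulVecLin _)).2 fun v hv => ?_
  have hq : ∑ ν : Fin N, v ν • p ν = 0 := by
    refine Polynomial.eq_zero_of_degree_lt_of_eval_index_eq_zero Finset.univ
      hx.injOn ?_ fun n _ => ?_
    · rw [Finset.card_univ, Fintype.card_fin, ← Polynomial.mem_degreeLT]
      refine Submodule.sum_mem _ fun ν _ => Submodule.smul_mem _ _ ?_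
      rw [Polynomial.mem_degreeLT, hdeg]
      exact_mod_cast ν.isLt
    · simpa [Matrix.mulVec, dotProduct, Polynomial.eval_finsetSum, mul_comm] using congrFun hv n
  let S : Polynomial.Sequence ℝ := ⟨p, hdeg⟩
  have hli : LinearIndependent ℝ fun ν : Fin N => p ν :=
    S.linearIndependent.comp _ Fin.val_injective
  exact funext (Fintype.linearIndependent_iff.1 hli v hq)

theorem stmt5
    (ω : Measure ℝ)
    (hmom : ∀ n : ℕ, Integrable (fun t : ℝ => t ^ n) ω)
    (hsupp : {t : ℝ | ∀ U ∈ nhds t, 0 < ω U}.Infinite)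
    (p : ℕ → Polynomial ℝ)
    (hdeg : ∀ ν : ℕ, (p ν).degree = ν)
    (horth : ∀ μ' ν : ℕ, μ' ≠ ν → ∫ t, (p μ').eval t * (p ν).eval t ∂ω = 0)
    (hnorm : ∀ ν : ℕ, 0 < ∫ t, ((p ν).eval t) ^ 2 ∂ω)
    (D : Polynomial ℝ →ₗ[ℝ] Polynomial ℝ)
    (hD : ∀ (ν : ℕ) (q : Polynomial ℝ), q.degree ≤ (ν : WithBot ℕ) →
      (D q).degree ≤ (ν : WithBot ℕ))
    (N : ℕ) (hN : 0 < N)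
    (μ : Fin N → ℝ)
    (hDp : ∀ ν : Fin N, D (p ν) = μ ν • p ν)
    (x : Fin N → ℝ) (hx : Function.Injective x)
    (Dc : Matrix (Fin N) (Fin N) ℝ)
    (hDc : ∀ n k : Fin N, Dc n k = (D (lag x k)).eval (x n)) :
    ∃ L : Matrix (Fin N) (Fin N) ℝ,
      IsUnit L ∧ Dc = L⁻¹ * Matrix.diagonal (fun ν : Fin N => μ ν) * L := by
  have hV := isUnit_collocation hdeg hx
  set V : Matrix (Fin N) (Fin N) ℝ := Matrix.of fun n ν : Fin N => (p ν).eval (x n)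
  have hDV : Dc * V = V * Matrix.diagonal (fun ν : Fin N => μ ν) := by
    ext n ν
    have hlt : (p ν).degree < N := by rw [hdeg]; exact_mod_cast ν.isLt
    have h : ∑ k, (p ν).eval (x k) * (D (lag x k)).eval (x n) = μ ν * (p ν).eval (x n) := by
      have := congrArg (fun q => (D q).eval (x n)) (sum_eval_smul_lag hx hlt)
      simpa [map_sum, Polynomial.eval_finsetSum, hDp] using this
    rw [Matrix.mul_diagonal, Matrix.mul_apply]
    simpa [V, hDc, mul_comm] using h
  have hdet : IsUnit V.det := (Matrix.isUnit_iff_isUnit_det V).1 hV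
  refine ⟨V⁻¹, (Matrix.isUnit_nonsing_inv_iff).2 hV, ?_⟩
  rw [Matrix.nonsing_inv_nonsing_inv V hdet, ← hDV, Matrix.mul_nonsing_inv_cancel_right _ _ hdet]
end

section
/- Let x_1,…,x_N be N pairwise distinct real numbers. Then for every integer k ≥ 1 and all m ≠ n (1 ≤ m, n ≤ N), the k-th derivative of the Lagrange basis polynomial ℓ_n at the node x_m admits the closed form ℓ_n^{(k)}(x_m) = (1/ψ_N'(x_n)) · ∑_{j=1}^k (−1)^{k−j} (k!/j!) · ψ_N^{(j)}(x_m) / (x_m − x_n)^{k−j+1}, where ψ_N^{(j)} denotes the j-th derivative of the node polynomial. -/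
open Polynomial Finset

/-- The node polynomial `ψ_N(t) = ∏_j (t − x_j)`. -/
noncomputable def nodePoly {N : ℕ} (x : Fin N → ℝ) : Polynomial ℝ :=
  ∏ j, (Polynomial.X - Polynomial.C (x j))

/-- `dvl q k t` is the `k`-th derivative of the polynomial `q`, evaluated at `t`. -/
noncomputable def dvl (q : Polynomial ℝ) (k : ℕ) (t : ℝ) : ℝ :=
  (Polynomial.derivative^[k] q).eval t

theorem X_sub_C_mul_lag {N : ℕ} (x : Fin N → ℝ) (n : Fin N) :
    (X - C (x n)) * lag x n = C (1 / dvl (nodePoly x) 1 (x n)) * nodePoly x := by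
  have hψ : nodePoly x = (X - C (x n)) * ∏ k ∈ univ.erase n, (X - C (x k)) :=
    (mul_prod_erase univ _ (mem_univ n)).symm
  have hderiv : dvl (nodePoly x) 1 (x n) = ∏ k ∈ univ.erase n, (x n - x k) := by
    simp [dvl, hψ, eval_prod]
  rw [hderiv, hψ, lag, prod_mul_distrib, ← map_prod, prod_inv_distrib, one_div]
  ring

theorem dvl_X_sub_C_mul_succ (q : ℝ[X]) (k : ℕ) (a t : ℝ) :
    dvl ((X - C a) * q) (k + 1) t = (t - a) * dvl q (k + 1) t + (k + 1) * dvl q k t := by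
  induction k generalizing q with
  | zero => simp [dvl]; ring
  | succ k ih =>
    have h : dvl ((X - C a) * q) (k + 1 + 1) t
        = dvl q (k + 1) t + dvl ((X - C a) * derivative q) (k + 1) t := by
      simp only [dvl, Function.iterate_succ_apply _ (k + 1), derivative_mul, derivative_X_sub_C,
        one_mul, iterate_map_add, eval_add]
    rw [h, ih]
    simp only [dvl, ← Function.iterate_succ_apply]
    push_cast
    ring

theorem dvl_C_mul (q : ℝ[X]) (k : ℕ) (c t : ℝ) : dvl (C c * q) k t = c * dvl q k t := by
  simp [dvl, iterate_derivative_C_mul]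

theorem eq_sum_of_first_order_recurrence {a p : ℕ → ℝ} {c d : ℝ} (hd : d ≠ 0) (h0 : a 0 = 0)
    (h : ∀ k : ℕ, d * a (k + 1) + (k + 1) * a k = c * p (k + 1)) (k : ℕ) :
    a k = c * ∑ j ∈ Icc 1 k,
      (-1 : ℝ) ^ (k - j) * ((k.factorial : ℝ) / (j.factorial : ℝ)) * p j / d ^ (k - j + 1) := by
  induction k with
  | zero => simp [h0]
  | succ k ih =>
    have hsum : ∑ j ∈ Icc 1 k, (-1 : ℝ) ^ (k + 1 - j) * (((k + 1).factorial : ℝ) / j.factorial) *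
          p j / d ^ (k + 1 - j + 1)
        = -((k + 1) / d) * ∑ j ∈ Icc 1 k,
          (-1 : ℝ) ^ (k - j) * ((k.factorial : ℝ) / j.factorial) * p j / d ^ (k - j + 1) := by
      rw [mul_sum]
      refine sum_congr rfl fun j hj => ?_
      have hj' : k + 1 - j = k - j + 1 := Nat.succ_sub (mem_Icc.mp hj).2
      rw [hj', Nat.factorial_succ, pow_succ (-1 : ℝ), pow_succ d (k - j + 1)]
      push_cast
      field_simp
    have hfac : ((k + 1).factorial : ℝ) ≠ 0 := by positivity
    rw [sum_Icc_succ_top (by omega), hsum, mul_add, mul_left_comm, ← ih, Nat.sub_self,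
      div_self hfac, pow_zero, zero_add, pow_one]
    have hk := h k
    field_simp
    linarith

theorem stmt15
    (N : ℕ) (x : Fin N → ℝ) (hx : Function.Injective x) :
    ∀ (k : ℕ), 1 ≤ k → ∀ (m n : Fin N), m ≠ n →
      dvl (lag x n) k (x m) =
        (1 / dvl (nodePoly x) 1 (x n)) *
          ∑ j ∈ Finset.Icc 1 k,
            (-1 : ℝ) ^ (k - j) * ((k.factorial : ℝ) / (j.factorial : ℝ)) *
              dvl (nodePoly x) j (x m) / (x m - x n) ^ (k - j + 1) := by
  intro k _ m n hmn
  have hd : x m - x n ≠ 0 := sub_ne_zero.mpr (hx.ne hmn)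
  have h0 : dvl (lag x n) 0 (x m) = 0 := by
    simp only [dvl, Function.iterate_zero, id, lag, eval_prod]
    exact prod_eq_zero (mem_erase.mpr ⟨hmn, mem_univ m⟩) (by simp)
  refine eq_sum_of_first_order_recurrence (a := fun k => dvl (lag x n) k (x m))
    (p := fun k => dvl (nodePoly x) k (x m)) hd h0 (fun k => ?_) k
  rw [← dvl_X_sub_C_mul_succ, X_sub_C_mul_lag, dvl_C_mul]
end

section
/- Let a_1, a_2, a_3, a_4 be real polynomials, μ ∈ ℝ, and let p be a real polynomial of degree N whose N zeros x_1,…,x_N are real and pairwise distinct, satisfying a_4 p'''' + a_3 p''' + a_2 p'' + a_1 p' = μ p. Form the Lagrange basis polynomials ℓ_n with respect to the nodes x_1,…,x_N. Then for every n = 1,…,N: 4a_4(x_n) ℓ_n'''(x_n) + 3a_3(x_n) ℓ_n''(x_n) + 2a_2(x_n) ℓ_n'(x_n) + a_1(x_n) = 0. -/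
open Polynomial Finset

theorem eval_lag_self {N : ℕ} {x : Fin N → ℝ} (hx : Function.Injective x) (n : Fin N) :
    (lag x n).eval (x n) = 1 := by
  rw [lag, eval_prod]
  refine Finset.prod_eq_one fun k hk => ?_
  have hne : x n - x k ≠ 0 := sub_ne_zero.2 fun h => (Finset.ne_of_mem_erase hk) (hx h).symm
  simp [hne]

theorem prod_sub_ne_zero {N : ℕ} {x : Fin N → ℝ} (hx : Function.Injective x) (n : Fin N) :
    ∏ k ∈ Finset.univ.erase n, (x n - x k) ≠ 0 :=
  Finset.prod_ne_zero_iff.2 fun _ hk =>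
    sub_ne_zero.2 fun h => (Finset.ne_of_mem_erase hk) (hx h).symm

theorem prod_X_sub_C_eq_mul_lag {N : ℕ} {x : Fin N → ℝ} (hx : Function.Injective x)
    (n : Fin N) :
    ∏ k, (X - C (x k)) =
      C (∏ k ∈ Finset.univ.erase n, (x n - x k)) * ((X - C (x n)) * lag x n) := by
  rw [lag, Finset.prod_mul_distrib, ← map_prod C, Finset.prod_inv_distrib,
    ← Finset.mul_prod_erase _ _ (Finset.mem_univ n), mul_left_comm (X - C (x n)),
    ← mul_assoc, ← C_mul, mul_inv_cancel₀ (prod_sub_ne_zero hx n), C_1, one_mul]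

theorem exists_eq_C_mul_prod_X_sub_C {N : ℕ} {p : Polynomial ℝ}
    (hp : p.degree = (N : WithBot ℕ)) {x : Fin N → ℝ} (hx : Function.Injective x)
    (hzero : ∀ n, p.eval (x n) = 0) :
    ∃ c : ℝ, c ≠ 0 ∧ p = C c * ∏ k, (X - C (x k)) := by
  obtain ⟨q, hq⟩ : ∏ k, (X - C (x k)) ∣ p :=
    Finset.prod_dvd_of_coprime ((pairwise_coprime_X_sub_C hx).set_pairwise _)
      fun k _ => dvd_iff_isRoot.2 (hzero k)
  have hp0 : p ≠ 0 := by
    rintro rfl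
    simp at hp
  have hq0 : q ≠ 0 := by
    rintro rfl
    simp [hp0] at hq
  have hdeg : q.natDegree = 0 := by
    have h := natDegree_eq_of_degree_eq_some hp
    rw [hq, (monic_prod_of_monic _ _ fun k _ => monic_X_sub_C (x k)).natDegree_mul' hq0,
      natDegree_prod_of_monic _ _ fun k _ => monic_X_sub_C (x k)] at h
    simpa using h
  obtain ⟨c, rfl⟩ := natDegree_eq_zero.1 hdeg
  exact ⟨c, by simpa using hq0, by rw [hq, mul_comm]⟩

/-- Leibniz rule for a linear factor, at its zero. -/
theorem eval_iterate_derivative_C_mul_X_sub_C_mul (d a : ℝ) (f : Polynomial ℝ) (k : ℕ) :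
    (derivative^[k + 1] (C d * ((X - C a) * f))).eval a =
      d * ((k + 1) * (derivative^[k] f).eval a) := by
  have h : ∀ k : ℕ, derivative^[k + 1] ((X - C a) * f) =
      (X - C a) * derivative^[k + 1] f + ((k : ℝ[X]) + 1) * derivative^[k] f := by
    intro k
    induction k with
    | zero => simp; ring
    | succ k ih =>
      rw [Function.iterate_succ_apply', ih]
      simp only [derivative_add, derivative_mul, derivative_sub, derivative_X, derivative_C,
        derivative_natCast, derivative_one, ← Function.iterate_succ_apply' derivative]
      push_cast
      ring
  rw [iterate_derivative_C_mul, h]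
  simp

theorem stmt17
    (a₁ a₂ a₃ a₄ : Polynomial ℝ) (μ : ℝ)
    (N : ℕ) (p : Polynomial ℝ) (hp : p.degree = (N : WithBot ℕ))
    (x : Fin N → ℝ) (hx : Function.Injective x)
    (hzero : ∀ n : Fin N, p.eval (x n) = 0)
    (hODE : a₄ * Polynomial.derivative^[4] p + a₃ * Polynomial.derivative^[3] p +
        a₂ * Polynomial.derivative^[2] p + a₁ * Polynomial.derivative p =
      Polynomial.C μ * p) :
    ∀ n : Fin N,
      4 * a₄.eval (x n) * dvl (lag x n) 3 (x n)
        + 3 * a₃.eval (x n) * dvl (lag x n) 2 (x n)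
        + 2 * a₂.eval (x n) * dvl (lag x n) 1 (x n)
        + a₁.eval (x n) = 0 := by
  intro n
  obtain ⟨c, hc, hpc⟩ := exists_eq_C_mul_prod_X_sub_C hp hx hzero
  rw [prod_X_sub_C_eq_mul_lag hx n, ← mul_assoc, ← C_mul] at hpc
  set d := c * ∏ k ∈ Finset.univ.erase n, (x n - x k)
  have hd0 : d ≠ 0 := mul_ne_zero hc (prod_sub_ne_zero hx n)
  have key (k : ℕ) : (derivative^[k + 1] p).eval (x n) = d * ((k + 1) * dvl (lag x n) k (x n)) := by
    rw [hpc]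
    exact eval_iterate_derivative_C_mul_X_sub_C_mul _ _ _ _
  have h0 : dvl (lag x n) 0 (x n) = 1 := eval_lag_self hx n
  have h1 : (derivative p).eval (x n) = d := by simpa [h0] using key 0
  have h := congrArg (eval (x n)) hODE
  simp only [eval_add, eval_mul, eval_C, hzero, key 1, key 2, key 3, h1] at h
  push_cast at h
  apply mul_left_cancel₀ hd0
  linear_combination h
end
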